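/- For every w ∈ W_s^k (a closed (n,d)-word of length k+1 with N_w(τ) ≠ 1 for every d-cell τ and |supp_0(w)| = s), the number m_w of words in its FK parsing a_w satisfies 1 ≤ m_w ≤ k + 1 − 2(s − d). -/

import Mathlib

open Filter

noncomputable section

def LMidx (τ s : Finset ℕ) : ℕ := (τ.filter (fun x => ∃ y ∈ s, x < y)).card

/-- `w` is an `(n,d)`-word: a nonempty sequence of letters ((d-1)-cells of the complete
complex `K(d,n)`) such that the union of any two consecutive letters is a d-cell. -/
def IsWord (n d : ℕ) (w : List (Finset ℕ)) : Prop :=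
  w ≠ [] ∧ (∀ σ ∈ w, σ ⊆ Finset.range n ∧ σ.card = d) ∧
    List.Chain' (fun σ σ' => (σ ∪ σ').card = d + 1) w

/-- `supp₀(w)`: the set of 0-cells (vertices) appearing in `w`. -/
def supp0 (w : List (Finset ℕ)) : Finset ℕ := w.foldr (· ∪ ·) ∅

/-- The list of steps (crossings) of the word `w`. -/
def steps (w : List (Finset ℕ)) : List (Finset ℕ × Finset ℕ) := w.zip w.tail

/-- `supp_d(w)`: the set of d-cells crossed by `w`. -/
def suppd (w : List (Finset ℕ)) : Finset (Finset ℕ) :=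
  ((steps w).map (fun p => p.1 ∪ p.2)).toFinset

/-- `N_w(τ)`: the number of crossings of the d-cell `τ` along `w`. -/
def Ncell (w : List (Finset ℕ)) (τ : Finset ℕ) : ℕ :=
  ((steps w).filter (fun p => p.1 ∪ p.2 = τ)).length

/-- `N_w({a,b})`: the number of crossings of the (unordered) edge `{a,b}` of `G_w` along `w`. -/
def Nedge (w : List (Finset ℕ)) (a b : Finset ℕ) : ℕ :=
  ((steps w).filter (fun p => (p.1 = a ∧ p.2 = b) ∨ (p.1 = b ∧ p.2 = a))).length

/-- `E_w`: the edge set of the graph `G_w` (an edge is recorded as the 1- or 2-element set of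
its endpoints). -/
def edgeSet (w : List (Finset ℕ)) : Finset (Finset (Finset ℕ)) :=
  ((steps w).map (fun p => ({p.1, p.2} : Finset (Finset ℕ)))).toFinset

/-- `V_w`: vertex set of the graph `G_w`. -/
def vertSet (w : List (Finset ℕ)) : Finset (Finset ℕ) := w.toFinset

def IsClosedWord (w : List (Finset ℕ)) : Prop := w.head? = w.getLast?

/-- Two words are equivalent if a permutation of the vertices maps one to the other. -/
def WordEquiv (w w' : List (Finset ℕ)) : Prop :=
  ∃ π : Equiv.Perm ℕ, w' = w.map (fun σ => σ.image π)

/-- The number of equivalence classes of words satisfying `P`. -/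
noncomputable def numClasses (P : List (Finset ℕ) → Prop) : ℕ :=
  Set.ncard {c : Set (List (Finset ℕ)) | ∃ w, P w ∧ c = {w' | P w' ∧ WordEquiv w w'}}

/-- Membership in (the set of words represented by) `W_s^k`. -/
def InW (n d k s : ℕ) (w : List (Finset ℕ)) : Prop :=
  IsWord n d w ∧ IsClosedWord w ∧ w.length = k + 1 ∧
    (∀ τ : Finset ℕ, Ncell w τ ≠ 1) ∧ (supp0 w).card = s

/-- `Σ_{e ∈ Ê_w(τ)} N_w(e)`: the number of crossings of `τ` between non-neighboring
(anti-oriented) `(d-1)`-cells, with respect to the increasing orientation. -/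
def NedgeHat (w : List (Finset ℕ)) (τ : Finset ℕ) : ℕ :=
  ((steps w).filter (fun p => p.1 ∪ p.2 = τ ∧
    Even (LMidx τ (p.2 \ p.1) + LMidx τ (p.1 \ p.2)))).length

/-- The sign `sgn(w,τ)`. -/
def sgnW (w : List (Finset ℕ)) (τ : Finset ℕ) : ℤ := (-1) ^ NedgeHat w τ

/-- The `i`-th letter of `w` (0-indexed). -/
def letterAt (w : List (Finset ℕ)) (i : ℕ) : Finset ℕ := w.getD i ∅

/-- The step `j` of `w` crosses the unordered edge `{a,b}`. -/
def stepIs (w : List (Finset ℕ)) (j : ℕ) (a b : Finset ℕ) : Prop :=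
  (letterAt w j = a ∧ letterAt w (j + 1) = b) ∨ (letterAt w j = b ∧ letterAt w (j + 1) = a)

/-- The number of crossings of the edge `{a,b}` among the first `m` steps of `w`. -/
noncomputable def cntEdge (w : List (Finset ℕ)) (a b : Finset ℕ) (m : ℕ) : ℕ :=
  Set.ncard {j | j < m ∧ stepIs w j a b}

/-- The edge `{a,b}` of `G_w` is new: at some crossing of it the second letter has not
appeared before. -/
def IsNewEdge (w : List (Finset ℕ)) (a b : Finset ℕ) : Prop :=
  ∃ j, j + 1 < w.length ∧ stepIs w j a b ∧ letterAt w (j + 1) ∉ w.take (j + 1)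

/-- The FK parsing of `w` is split at step `i`. -/
def FKsplit (w : List (Finset ℕ)) (i : ℕ) : Prop :=
  ¬ IsNewEdge w (letterAt w i) (letterAt w (i + 1))
  ∨ 2 ≤ cntEdge w (letterAt w i) (letterAt w (i + 1)) i
  ∨ (cntEdge w (letterAt w i) (letterAt w (i + 1)) i = 1 ∧
      ∃ a b, a ∪ b = letterAt w i ∪ letterAt w (i + 1) ∧ 2 ≤ cntEdge w a b i)

/-- The number `m_w` of words in the FK parsing `a_w` of `w`. -/
noncomputable def mFK (w : List (Finset ℕ)) : ℕ :=
  1 + Set.ncard {i | i + 1 < w.length ∧ FKsplit w i}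

/-- The graph `G_w` of the word `w`, as a simple graph on the letters of `w`. -/
def wordGraph (w : List (Finset ℕ)) : SimpleGraph {σ // σ ∈ w.toFinset} :=
  SimpleGraph.fromRel (fun a b => ∃ j, j + 1 < w.length ∧ stepIs w j a.1 b.1)

/-- `w` is an FK word: its graph is a tree, no edge is crossed more than twice, and each
d-cell carries at most one edge that is crossed twice. -/
def IsFKWord (n d : ℕ) (w : List (Finset ℕ)) : Prop :=
  IsWord n d w ∧ (wordGraph w).IsTree ∧
    (∀ a b : Finset ℕ, ({a, b} : Finset (Finset ℕ)) ∈ edgeSet w → Nedge w a b ≤ 2) ∧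
    (∀ τ a b a' b' : Finset ℕ, ({a, b} : Finset (Finset ℕ)) ∈ edgeSet w →
      ({a', b'} : Finset (Finset ℕ)) ∈ edgeSet w → a ∪ b = τ → a' ∪ b' = τ →
      2 ≤ Nedge w a b → 2 ≤ Nedge w a' b' →
      ({a, b} : Finset (Finset ℕ)) = ({a', b'} : Finset (Finset ℕ)))

theorem List.length_filter_eq_one_of_unique {α : Type*} (p : α → Bool) (l : List α) (i : ℕ)
    (hi : i < l.length) (hp : p l[i] = true)
    (huniq : ∀ j (hj : j < l.length), p l[j] = true → j = i) : (l.filter p).length = 1 := by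
  have h1 : (l.take i).filter p = [] := by
    rw [List.filter_eq_nil_iff]
    intro a ha hpa
    obtain ⟨j, hj, rfl⟩ := List.mem_iff_getElem.1 ha
    simp only [List.length_take] at hj
    rw [List.getElem_take] at hpa
    have := huniq j (by omega) hpa
    omega
  have h2 : (l.drop (i + 1)).filter p = [] := by
    rw [List.filter_eq_nil_iff]
    intro a ha hpa
    obtain ⟨j, hj, rfl⟩ := List.mem_iff_getElem.1 ha
    simp only [List.length_drop] at hj
    rw [List.getElem_drop] at hpa
    have := huniq (i + 1 + j) (by omega) hpa
    omega
  have h3 : l = l.take i ++ l[i] :: l.drop (i + 1) := by simp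
  rw [h3, List.filter_append, List.filter_cons, h1, h2]
  simp [hp]

theorem letterAt_eq_getElem {w : List (Finset ℕ)} {i : ℕ} (hi : i < w.length) :
    letterAt w i = w[i] := by
  simp [letterAt, hi]

theorem lt_length_of_mem_letterAt {w : List (Finset ℕ)} {i x : ℕ} (hx : x ∈ letterAt w i) :
    i < w.length := by
  by_contra h
  rw [letterAt, List.getD_eq_default _ _ (not_lt.1 h)] at hx
  exact Finset.notMem_empty x hx

theorem letterAt_mem {w : List (Finset ℕ)} {i : ℕ} (hi : i < w.length) : letterAt w i ∈ w := by
  rw [letterAt_eq_getElem hi]; exact List.getElem_mem hi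

theorem mem_supp0_iff {w : List (Finset ℕ)} {x : ℕ} : x ∈ supp0 w ↔ ∃ i, x ∈ letterAt w i := by
  have key : x ∈ supp0 w ↔ ∃ σ ∈ w, x ∈ σ := by
    induction w with
    | nil => simp [supp0]
    | cons a l ih => simp only [supp0, List.foldr_cons, Finset.mem_union] at ih ⊢; simp [ih]
  rw [key]
  constructor
  · rintro ⟨σ, hσ, hx⟩
    obtain ⟨i, hi, rfl⟩ := List.mem_iff_getElem.1 hσ
    exact ⟨i, by rwa [letterAt_eq_getElem hi]⟩
  · rintro ⟨i, hx⟩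
    exact ⟨_, letterAt_mem (lt_length_of_mem_letterAt hx), hx⟩

theorem mem_take_iff_letterAt {w : List (Finset ℕ)} {σ : Finset ℕ} {m : ℕ} (hm : m ≤ w.length) :
    σ ∈ w.take m ↔ ∃ i < m, letterAt w i = σ := by
  rw [List.mem_take_iff_getElem]
  constructor
  · rintro ⟨i, hi, rfl⟩
    exact ⟨i, by omega, letterAt_eq_getElem (by omega)⟩
  · rintro ⟨i, hi, rfl⟩
    exact ⟨i, by omega, (letterAt_eq_getElem (by omega)).symm⟩

/-- A d-cell crossed at step `i` and at no other step has `N_w = 1`. -/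
theorem Ncell_eq_one_of_unique {w : List (Finset ℕ)} {τ : Finset ℕ} {i : ℕ}
    (hi : i + 1 < w.length) (hτ : letterAt w i ∪ letterAt w (i + 1) = τ)
    (huniq : ∀ j, j + 1 < w.length → letterAt w j ∪ letterAt w (j + 1) = τ → j = i) :
    Ncell w τ = 1 := by
  have hlen : (steps w).length = w.length - 1 := by simp [steps]
  have hget : ∀ j (hj : j < (steps w).length),
      (steps w)[j] = (letterAt w j, letterAt w (j + 1)) := by
    intro j hj
    rw [letterAt_eq_getElem (by omega), letterAt_eq_getElem (by omega)]
    simp [steps]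
  refine List.length_filter_eq_one_of_unique _ _ i (by omega) ?_ ?_
  · rw [hget]; simpa using hτ
  · intro j hj h
    rw [hget] at h
    exact huniq j (by omega) (by simpa using h)

theorem stepIs_self (w : List (Finset ℕ)) (i : ℕ) :
    stepIs w i (letterAt w i) (letterAt w (i + 1)) := Or.inl ⟨rfl, rfl⟩

theorem stepIs.union_eq {w : List (Finset ℕ)} {j : ℕ} {a b : Finset ℕ} (h : stepIs w j a b) :
    letterAt w j ∪ letterAt w (j + 1) = a ∪ b := by
  rcases h with ⟨rfl, rfl⟩ | ⟨rfl, rfl⟩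
  · rfl
  · exact Finset.union_comm _ _

/-- A step crosses the edge of step `j` iff it crosses any edge `{a,b}` that step `j` crosses. -/
theorem stepIs.congr {w : List (Finset ℕ)} {j : ℕ} {a b : Finset ℕ} (h : stepIs w j a b) (i : ℕ) :
    stepIs w i (letterAt w j) (letterAt w (j + 1)) ↔ stepIs w i a b := by
  rcases h with ⟨h1, h2⟩ | ⟨h1, h2⟩ <;> rw [h1, h2]
  exact or_comm

/-- The letter reached at step `j` is visited there for the first time. -/
def ReachesNewLetter (w : List (Finset ℕ)) (j : ℕ) : Prop :=
  ∀ i ≤ j, letterAt w i ≠ letterAt w (j + 1)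

theorem ReachesNewLetter.isNewEdge {w : List (Finset ℕ)} {j : ℕ} (h : ReachesNewLetter w j)
    (hj : j + 1 < w.length) : IsNewEdge w (letterAt w j) (letterAt w (j + 1)) := by
  refine ⟨j, hj, stepIs_self w j, ?_⟩
  rw [mem_take_iff_letterAt hj.le]
  rintro ⟨i, hi, h'⟩
  exact h i (by omega) h'

theorem ReachesNewLetter.le_of_stepIs {w : List (Finset ℕ)} {i j : ℕ} (h : ReachesNewLetter w j)
    (hs : stepIs w i (letterAt w j) (letterAt w (j + 1))) : j ≤ i := by
  by_contra hlt
  rcases hs with ⟨_, h2⟩ | ⟨h1, _⟩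
  · exact h (i + 1) (by omega) h2
  · exact h i (by omega) h1

theorem ReachesNewLetter.not_FKsplit {w : List (Finset ℕ)} {j : ℕ} (h : ReachesNewLetter w j)
    (hj : j + 1 < w.length) : ¬ FKsplit w j := by
  have h0 : cntEdge w (letterAt w j) (letterAt w (j + 1)) j = 0 := by
    have : {i | i < j ∧ stepIs w i (letterAt w j) (letterAt w (j + 1))} = ∅ := by
      ext i
      simp only [Set.mem_ofPred_eq, Set.mem_empty_iff_false, iff_false, not_and]
      intro hi hs
      have := h.le_of_stepIs hs
      omega
    rw [cntEdge, this, Set.ncard_empty]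
  rintro (h' | h' | h')
  · exact h' (h.isNewEdge hj)
  · omega
  · omega

/-- If every crossing of a d-cell before step `j` is step `i`, which reached a new letter, then
the crossing at step `j` of the same edge is not a split of the FK parsing. -/
theorem not_FKsplit_of_second_crossing {w : List (Finset ℕ)} {i j : ℕ}
    (hi : ReachesNewLetter w i) (hil : i + 1 < w.length)
    (hs : stepIs w j (letterAt w i) (letterAt w (i + 1)))
    (honly : ∀ m < j, letterAt w m ∪ letterAt w (m + 1) = letterAt w i ∪ letterAt w (i + 1) →
      m = i) : ¬ FKsplit w j := by
  have hcnt : ∀ a b, a ∪ b = letterAt w i ∪ letterAt w (i + 1) → cntEdge w a b j ≤ 1 := by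
    intro a b hab
    refine (Set.ncard_le_ncard (t := {i}) ?_ (Set.finite_singleton i)).trans_eq
      (Set.ncard_singleton i)
    rintro m ⟨hm, hms⟩
    exact honly m hm (hms.union_eq.trans hab)
  have hu := hs.union_eq
  rintro (h | h | ⟨_, a, b, hab, h⟩)
  · obtain ⟨m, hm, hms, hmn⟩ := hi.isNewEdge hil
    exact h ⟨m, hm, (hs.congr m).2 hms, hmn⟩
  · have := hcnt _ _ hu
    omega
  · have := hcnt a b (hab.trans hu)
    omega

/-- The index of the first letter of `w` containing the vertex `x`. -/
def firstIdx (w : List (Finset ℕ)) (x : ℕ) : ℕ := sInf {i | x ∈ letterAt w i}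

theorem firstIdx_le {w : List (Finset ℕ)} {x i : ℕ} (h : x ∈ letterAt w i) : firstIdx w x ≤ i :=
  Nat.sInf_le h

theorem mem_letterAt_firstIdx {w : List (Finset ℕ)} {x : ℕ} (h : x ∈ supp0 w) :
    x ∈ letterAt w (firstIdx w x) :=
  Nat.sInf_mem (s := {i | x ∈ letterAt w i}) (mem_supp0_iff.1 h)

theorem IsWord.card_letterAt {n d i : ℕ} {w : List (Finset ℕ)} (hw : IsWord n d w)
    (hi : i < w.length) : (letterAt w i).card = d :=
  (hw.2.1 _ (letterAt_mem hi)).2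

theorem IsWord.card_union {n d i : ℕ} {w : List (Finset ℕ)} (hw : IsWord n d w)
    (hi : i + 1 < w.length) : (letterAt w i ∪ letterAt w (i + 1)).card = d + 1 := by
  rw [letterAt_eq_getElem hi, letterAt_eq_getElem (by omega)]
  exact List.isChain_iff_getElem.1 hw.2.2 i hi

/-- A step into a vertex `v` outside the current letter crosses the d-cell obtained from that
letter by adding `v`. -/
theorem IsWord.union_eq_insert {n d i v : ℕ} {w : List (Finset ℕ)} (hw : IsWord n d w)
    (hv : v ∈ letterAt w (i + 1)) (hv' : v ∉ letterAt w i) :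
    letterAt w i ∪ letterAt w (i + 1) = insert v (letterAt w i) := by
  have hi := lt_length_of_mem_letterAt hv
  symm
  apply Finset.eq_of_subset_of_card_le
  · intro x hx
    rcases Finset.mem_insert.1 hx with rfl | hx
    · exact Finset.mem_union_right _ hv
    · exact Finset.mem_union_left _ hx
  · rw [hw.card_union hi, Finset.card_insert_of_notMem hv', hw.card_letterAt (by omega)]

/-- The step at which a vertex `v` outside the first letter is discovered. -/
theorem exists_discovery_step {w : List (Finset ℕ)} {v : ℕ} (hv : v ∈ supp0 w \ letterAt w 0) :
    ∃ i, firstIdx w v = i + 1 ∧ v ∈ letterAt w (i + 1) ∧ ∀ m ≤ i, v ∉ letterAt w m := by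
  rw [Finset.mem_sdiff] at hv
  have hmem := mem_letterAt_firstIdx hv.1
  obtain ⟨i, hi⟩ : ∃ i, firstIdx w v = i + 1 :=
    Nat.exists_eq_succ_of_ne_zero fun h => hv.2 (h ▸ hmem)
  refine ⟨i, hi, hi ▸ hmem, fun m hm h => ?_⟩
  have := firstIdx_le h
  omega

theorem IsWord.firstIdx_injOn {n d : ℕ} {w : List (Finset ℕ)} (hw : IsWord n d w) :
    Set.InjOn (firstIdx w) ↑(supp0 w \ letterAt w 0) := by
  intro u hu v hv huv
  obtain ⟨i, hi, hui, hui'⟩ := exists_discovery_step (Finset.mem_coe.1 hu)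
  obtain ⟨j, hj, hvj, hvj'⟩ := exists_discovery_step (Finset.mem_coe.1 hv)
  obtain rfl : i = j := by omega
  have : u ∈ insert v (letterAt w i) := by
    rw [← hw.union_eq_insert hvj (hvj' i le_rfl)]
    exact Finset.mem_union_right _ hui
  exact (Finset.mem_insert.1 this).resolve_right (hui' i le_rfl)

open Classical in
/-- The vertices among which a step looks for the one it is charged to: those of the letter
reached if it is new, and those of the d-cell crossed otherwise. -/
def chargeSet (w : List (Finset ℕ)) (j : ℕ) : Finset ℕ :=
  if ReachesNewLetter w j then letterAt w (j + 1) else letterAt w j ∪ letterAt w (j + 1)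

/-- The step `j` is charged to `v`: the last discovered vertex of `chargeSet w j` is `v`. -/
def ChargedTo (w : List (Finset ℕ)) (j v : ℕ) : Prop :=
  v ∈ chargeSet w j ∧ ∀ u ∈ chargeSet w j, firstIdx w u ≤ firstIdx w v

/-- Every vertex outside the first letter has two steps charged to it at which the FK parsing is
not split. -/
theorem exists_two_charged {n d v : ℕ} {w : List (Finset ℕ)} (hw : IsWord n d w)
    (hN : ∀ τ, Ncell w τ ≠ 1) (hv : v ∈ supp0 w \ letterAt w 0) :
    ∃ i j, i ≠ j ∧ (i + 1 < w.length ∧ ¬ FKsplit w i ∧ ChargedTo w i v) ∧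
      (j + 1 < w.length ∧ ¬ FKsplit w j ∧ ChargedTo w j v) := by
  obtain ⟨i, hi, hvi, hvi'⟩ := exists_discovery_step hv
  have hil := lt_length_of_mem_letterAt hvi
  have hcell := hw.union_eq_insert hvi (hvi' i le_rfl)
  set τ := letterAt w i ∪ letterAt w (i + 1) with hτ
  have hlast : ∀ u ∈ τ, firstIdx w u ≤ firstIdx w v := by
    intro u hu
    rw [hcell, Finset.mem_insert] at hu
    rcases hu with rfl | hu
    · rfl
    · have := firstIdx_le hu
      omega
  have hnew : ReachesNewLetter w i := fun m hm h => hvi' m hm (h ▸ hvi)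
  have hchi : ChargedTo w i v := by
    rw [ChargedTo, chargeSet, if_pos hnew]
    exact ⟨hvi, fun u hu => hlast u (Finset.mem_union_right _ hu)⟩
  have hfirst := And.intro hil (And.intro (hnew.not_FKsplit hil) hchi)
  by_cases hall : ∀ j, j + 1 < w.length → letterAt w j ∪ letterAt w (j + 1) = τ →
      stepIs w j (letterAt w i) (letterAt w (i + 1))
  · have hex : ∃ j, j + 1 < w.length ∧ letterAt w j ∪ letterAt w (j + 1) = τ ∧ j ≠ i := by
      by_contra! hno
      exact hN τ (Ncell_eq_one_of_unique hil rfl hno)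
    classical
    obtain ⟨hjl, hjτ, hji⟩ := Nat.find_spec hex
    have hmin := fun m => Nat.find_min hex (m := m)
    set j := Nat.find hex
    have hs := hall j hjl hjτ
    have hij := hnew.le_of_stepIs hs
    have hold : ¬ ReachesNewLetter w j := by
      intro h
      rcases hs with ⟨_, h2⟩ | ⟨_, h2⟩
      · exact h (i + 1) (by omega) h2.symm
      · exact h i hij h2.symm
    refine ⟨i, j, hji.symm, hfirst, hjl, ?_, ?_⟩
    · refine not_FKsplit_of_second_crossing hnew hil hs fun m hm hmτ => ?_
      by_contra hmi
      exact hmin m hm ⟨by omega, hmτ, hmi⟩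
    · rw [ChargedTo, chargeSet, if_neg hold, hjτ, hcell]
      exact ⟨Finset.mem_insert_self _ _, hcell ▸ hlast⟩
  · push Not at hall
    obtain ⟨j, hjl, hjτ, hns⟩ := hall
    have hne : letterAt w j ≠ letterAt w (j + 1) := by
      intro h
      have h1 := hw.card_union hjl
      rw [← h, Finset.union_self, hw.card_letterAt (by omega)] at h1
      omega
    have hq : ∃ q < w.length, letterAt w q ⊆ τ ∧ letterAt w q ≠ letterAt w i ∧
        letterAt w q ≠ letterAt w (i + 1) := by
      by_contra! hno
      have h1 := hno j (by omega) (hjτ ▸ Finset.subset_union_left)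
      have h2 := hno (j + 1) hjl (hjτ ▸ Finset.subset_union_right)
      apply hns
      by_cases ha : letterAt w j = letterAt w i
      · exact Or.inl ⟨ha, h2 fun h => hne (ha.trans h.symm)⟩
      · refine Or.inr ⟨h1 ha, ?_⟩
        by_contra hb
        exact hne ((h1 ha).trans (h2 hb).symm)
    classical
    obtain ⟨hql, hqτ, hqi, hqi'⟩ := Nat.find_spec hq
    have hmin := fun m => Nat.find_min hq (m := m)
    set q := Nat.find hq
    have hvq : v ∈ letterAt w q := by
      by_contra hvq
      refine hqi (Finset.eq_of_subset_of_card_le ?_ ?_)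
      · rw [hcell] at hqτ
        exact (Finset.subset_insert_iff_of_notMem hvq).1 hqτ
      · rw [hw.card_letterAt hql, hw.card_letterAt (by omega)]
    obtain ⟨p, hp⟩ : ∃ p, q = p + 1 := by
      refine Nat.exists_eq_succ_of_ne_zero fun h => ?_
      rw [h] at hvq
      exact hvi' 0 (Nat.zero_le _) hvq
    rw [hp] at hql hqτ hqi hqi' hvq hmin
    have hnewp : ReachesNewLetter w p := by
      intro m hm h
      exact hmin m (by omega) ⟨by omega, h ▸ hqτ, h ▸ hqi, h ▸ hqi'⟩
    refine ⟨i, p, fun h => hqi' (h ▸ rfl), hfirst, hql, hnewp.not_FKsplit hql, ?_⟩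
    rw [ChargedTo, chargeSet, if_pos hnewp]
    exact ⟨hvq, fun u hu => hlast u (hqτ hu)⟩

open Classical in
theorem two_mul_card_le_card_nonsplit {n d : ℕ} {w : List (Finset ℕ)} (hw : IsWord n d w)
    (hN : ∀ τ, Ncell w τ ≠ 1) :
    2 * (supp0 w \ letterAt w 0).card ≤
      ((Finset.range (w.length - 1)).filter fun i => ¬ FKsplit w i).card := by
  set S := supp0 w \ letterAt w 0 with hS
  set A := (Finset.range (w.length - 1)).filter fun i => ¬ FKsplit w i with hA
  have hdisj : (S : Set ℕ).PairwiseDisjoint fun v => A.filter fun i => ChargedTo w i v := by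
    intro u hu v hv huv
    refine Finset.disjoint_left.2 fun i hiu hiv => huv ?_
    have h1 := (Finset.mem_filter.1 hiu).2
    have h2 := (Finset.mem_filter.1 hiv).2
    exact hw.firstIdx_injOn hu hv (le_antisymm (h2.2 u h1.1) (h1.2 v h2.1))
  have htwo : ∀ v ∈ S, 2 ≤ (A.filter fun i => ChargedTo w i v).card := by
    intro v hv
    obtain ⟨i, j, hij, ⟨hi, hi', hi''⟩, hj, hj', hj''⟩ := exists_two_charged hw hN hv
    refine Finset.one_lt_card.2 ⟨i, ?_, j, ?_, hij⟩
    · simp only [hA, Finset.mem_filter, Finset.mem_range]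
      exact ⟨⟨by omega, hi'⟩, hi''⟩
    · simp only [hA, Finset.mem_filter, Finset.mem_range]
      exact ⟨⟨by omega, hj'⟩, hj''⟩
  calc 2 * S.card = ∑ _v ∈ S, 2 := by simp [mul_comm]
    _ ≤ ∑ v ∈ S, (A.filter fun i => ChargedTo w i v).card := Finset.sum_le_sum htwo
    _ = (S.biUnion fun v => A.filter fun i => ChargedTo w i v).card :=
        (Finset.card_biUnion hdisj).symm
    _ ≤ A.card := Finset.card_le_card (Finset.biUnion_subset.2 fun _ _ => Finset.filter_subset _ _)

/-- **Lemma 5.9.** For every `w ∈ W_s^k`, the number `m_w` of words in the FK parsing `a_w`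
of `w` satisfies `1 ≤ m_w ≤ k + 1 - 2(s - d)`. -/
theorem mFK_bounds (n d k s : ℕ) (hd : 2 ≤ d) (hn : d + 1 ≤ n)
    (w : List (Finset ℕ)) (hw : InW n d k s w) :
    1 ≤ mFK w ∧ (mFK w : ℤ) ≤ (k : ℤ) + 1 - 2 * ((s : ℤ) - (d : ℤ)) := by
  classical
  obtain ⟨hword, -, hlen, hN, hs⟩ := hw
  refine ⟨Nat.le_add_right 1 _, ?_⟩
  have hset : {i | i + 1 < w.length ∧ FKsplit w i} =
      ↑((Finset.range (w.length - 1)).filter fun i => FKsplit w i) := by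
    ext i
    simp only [Set.mem_ofPred_eq, Finset.coe_filter, Finset.mem_range]
    refine and_congr_left fun _ => ?_
    omega
  have hm : mFK w = 1 + ((Finset.range (w.length - 1)).filter fun i => FKsplit w i).card := by
    rw [mFK, hset, Set.ncard_coe_finset]
  have hsum := Finset.card_filter_add_card_filter_not (s := Finset.range (w.length - 1))
    (fun i => FKsplit w i)
  rw [Finset.card_range] at hsum
  have hnon := two_mul_card_le_card_nonsplit hword hN
  have hsub : letterAt w 0 ⊆ supp0 w := fun x hx => mem_supp0_iff.2 ⟨0, hx⟩
  have hS := Finset.card_sdiff_add_card_eq_card hsub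
  rw [hword.card_letterAt (by omega), hs] at hS
  omega
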